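/- With the same assumptions and notation as the mollifier estimate, for every η > 0 and x ∈ Ω with η < dist(x, ∂Ω), one has |D(φ_η ∗ v)(x)| ≤ C' η^{σ−1} D^{σ,p}v(x), where C' depends only on Dφ, m, σ, p. -/

import Mathlib

open MeasureTheory
open scoped ENNReal NNReal

/-- A ball around a point of an open set `Ω` that stays away from the frontier of `Ω` is
contained in `Ω`. -/
lemma ball_subset_of_le_infDist_frontier {E : Type*} [NormedAddCommGroup E] [NormedSpace ℝ E]
    {Ω : Set E} {x : E} {R : ℝ} (hΩ : IsOpen Ω)
    (hx : x ∈ Ω) (hR : 0 < R) (h : R ≤ Metric.infDist x (frontier Ω)) : Metric.ball x R ⊆ Ω := by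
  refine (convex_ball x R).isPreconnected.subset_of_closure_inter_subset hΩ
    ⟨x, Metric.mem_ball_self hR, hx⟩ fun y ⟨hyc, hy⟩ => ?_
  by_contra hyΩ
  have hle := Metric.infDist_le_dist_of_mem (x := x) (hΩ.frontier_eq ▸ ⟨hyc, hyΩ⟩ : y ∈ frontier Ω)
  rw [Metric.mem_ball, dist_comm] at hy
  linarith

/-- The mean oscillation of `v` on a ball is controlled by its Gagliardo fractional derivative at
the centre. -/
lemma lintegral_ball_enorm_sub_le {m : ℕ} {F : Type*} [NormedAddCommGroup F]
    {σ p : ℝ} (hσ0 : 0 < σ) (hp : 1 ≤ p)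
    {Ω : Set (EuclideanSpace ℝ (Fin m))} {v : EuclideanSpace ℝ (Fin m) → F}
    (hv : AEStronglyMeasurable v volume) {x : EuclideanSpace ℝ (Fin m)} {R : ℝ} (hR : 0 < R)
    (hsub : Metric.ball x R ⊆ Ω) :
    ∫⁻ y in Metric.ball x R, ‖v y - v x‖ₑ ≤
      volume (Metric.ball (0 : EuclideanSpace ℝ (Fin m)) 1) ^ (1 - 1 / p) *
        ENNReal.ofReal R ^ ((m : ℝ) + σ) *
        (∫⁻ y in Ω, ‖v x - v y‖ₑ ^ p / ‖x - y‖ₑ ^ ((m : ℝ) + σ * p)) ^ (1 / p) := by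
  have hp0 : 0 < p := by linarith
  have hR0 : ENNReal.ofReal R ≠ 0 := by simpa using hR
  have hm : AEStronglyMeasurable (fun y => v y - v x) (volume.restrict (Metric.ball x R)) :=
    (hv.sub aestronglyMeasurable_const).restrict
  have holder := eLpNorm'_le_eLpNorm'_mul_rpow_measure_univ one_pos hp hm
  simp only [eLpNorm', ENNReal.rpow_one, div_one, Measure.restrict_apply_univ] at holder
  have hpt : ∫⁻ y in Metric.ball x R, ‖v y - v x‖ₑ ^ p ≤ ENNReal.ofReal R ^ ((m : ℝ) + σ * p) *
      ∫⁻ y in Ω, ‖v x - v y‖ₑ ^ p / ‖x - y‖ₑ ^ ((m : ℝ) + σ * p) := by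
    rw [← lintegral_const_mul' _ _ (by finiteness)]
    refine (setLIntegral_mono' Metric.isOpen_ball.measurableSet fun y hy => ?_).trans
      (lintegral_mono_set hsub)
    rcases eq_or_ne y x with rfl | hyx
    · simp [hp0]
    · have h0 : ‖x - y‖ₑ ≠ 0 := by simpa [sub_eq_zero] using hyx.symm
      have hle : ‖x - y‖ₑ ≤ ENNReal.ofReal R := by
        rw [← ofReal_norm, ← dist_eq_norm, dist_comm]
        exact ENNReal.ofReal_le_ofReal (Metric.mem_ball.mp hy).le
      rw [← enorm_neg, neg_sub]
      calc ‖v x - v y‖ₑ ^ p = ‖x - y‖ₑ ^ ((m : ℝ) + σ * p) *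
            (‖v x - v y‖ₑ ^ p / ‖x - y‖ₑ ^ ((m : ℝ) + σ * p)) := by
              rw [ENNReal.mul_div_cancel]
              · simp [ENNReal.rpow_eq_zero_iff, h0]
              · finiteness
        _ ≤ _ := by gcongr
  refine holder.trans ?_
  rw [Measure.addHaar_ball_of_pos _ _ hR, finrank_euclideanSpace_fin, ENNReal.ofReal_pow hR.le]
  have h1p : 0 ≤ 1 - 1 / p := by
    rw [sub_nonneg, div_le_one hp0]; exact hp
  have hpow : ENNReal.ofReal R ^ ((m : ℝ) + σ) =
      (ENNReal.ofReal R ^ ((m : ℝ) + σ * p)) ^ (1 / p) *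
        (ENNReal.ofReal R ^ m) ^ (1 - 1 / p) := by
    rw [← ENNReal.rpow_natCast, ← ENNReal.rpow_mul, ← ENNReal.rpow_mul,
      ← ENNReal.rpow_add _ _ hR0 ENNReal.ofReal_ne_top]
    congr 1
    field_simp
    ring
  calc _ ≤ (ENNReal.ofReal R ^ ((m : ℝ) + σ * p) *
      ∫⁻ y in Ω, ‖v x - v y‖ₑ ^ p / ‖x - y‖ₑ ^ ((m : ℝ) + σ * p)) ^ (1 / p) *
        (ENNReal.ofReal R ^ m *
          volume (Metric.ball (0 : EuclideanSpace ℝ (Fin m)) 1)) ^ (1 - 1 / p) := by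
        gcongr
    _ = _ := by
        rw [ENNReal.mul_rpow_of_nonneg _ _ (by positivity : 0 ≤ 1 / p),
          ENNReal.mul_rpow_of_nonneg _ _ h1p, hpow]
        ring

/-- Convolving with a Lipschitz kernel supported in a ball of radius `η` gives a function whose
derivative at `x` is controlled by the oscillation of `v` around `v x` on any larger ball. -/
lemma norm_fderiv_integral_smul_le {E F : Type*} [NormedAddCommGroup E] [NormedSpace ℝ E]
    [FiniteDimensional ℝ E] [MeasurableSpace E] [BorelSpace E]
    [NormedAddCommGroup F] [NormedSpace ℝ F] [CompleteSpace F]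
    (μ : Measure E) [μ.IsAddHaarMeasure] {g : E → ℝ} {K : ℝ≥0} (hg : LipschitzWith K g)
    {η R : ℝ} (hηR : η < R) (hsupp : Function.support g ⊆ Metric.ball 0 η)
    {v : E → F} {x : E} (hv : IntegrableOn (fun y => v y - v x) (Metric.ball x R) μ) :
    ‖fderiv ℝ (fun z => ∫ y, g (z - y) • v y ∂μ) x‖ ≤
      K * ∫ y in Metric.ball x R, ‖v y - v x‖ ∂μ := by
  have hgc : HasCompactSupport g :=
    HasCompactSupport.of_support_subset_isCompact (isCompact_closedBall 0 η)
      (hsupp.trans Metric.ball_subset_closedBall)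
  obtain ⟨M, hM⟩ := hgc.exists_bound_of_continuous hg.continuous
  have hgcont (z : E) : Continuous fun y => g (z - y) := hg.continuous.comp (by fun_prop)
  have hint (z : E) : IntegrableOn (fun y => g (z - y) • (v y - v x)) (Metric.ball x R) μ :=
    hv.bdd_smul M (hgcont z).aestronglyMeasurable (ae_of_all _ fun y => hM _)
  have hgi (z : E) : Integrable (fun y => g (z - y)) μ :=
    (hg.continuous.integrable_of_hasCompactSupport hgc).comp_sub_left z
  have hrep {z : E} (hz : z ∈ Metric.ball x (R - η)) : ∫ y, g (z - y) • v y ∂μ =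
      (∫ y in Metric.ball x R, g (z - y) • (v y - v x) ∂μ) + (∫ y, g y ∂μ) • v x := by
    have hs (y : E) (hy : y ∉ Metric.ball x R) : g (z - y) = 0 := by
      by_contra h0
      have h1 := hsupp h0
      rw [mem_ball_zero_iff, ← dist_eq_norm, dist_comm] at h1
      rw [Metric.mem_ball] at hz hy
      linarith [dist_triangle y z x]
    have hi : Integrable (fun y => g (z - y) • (v y - v x)) μ :=
      (integrableOn_iff_integrable_of_support_subset fun y hy => by
        by_contra h; exact hy (by simp [hs y h])).mp (hint z)
    rw [setIntegral_eq_integral_of_forall_compl_eq_zero fun y hy => by simp [hs y hy],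
      ← integral_sub_left_eq_self g μ z, ← integral_smul_const,
      ← integral_add hi ((hgi z).smul_const _)]
    simp [smul_sub]
  refine norm_fderiv_le_of_lip' ℝ (by positivity) ?_
  filter_upwards [Metric.ball_mem_nhds x (sub_pos.mpr hηR)] with z hz
  rw [hrep hz, hrep (Metric.mem_ball_self (sub_pos.mpr hηR)), add_sub_add_right_eq_sub,
    ← integral_sub (hint z) (hint x)]
  calc _ ≤ ∫ y in Metric.ball x R, K * ‖z - x‖ * ‖v y - v x‖ ∂μ := by
        refine norm_integral_le_of_norm_le (hv.norm.const_mul _) (ae_of_all _ fun y => ?_)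
        rw [← sub_smul, norm_smul]
        gcongr
        simpa [dist_eq_norm] using hg.dist_le_mul (z - y) (x - y)
    _ = _ := by rw [integral_const_mul]; ring

/-- Mollifier gradient estimate: `|D(φ_η ∗ v)(x)| ≤ C' η^{σ-1} D^{σ,p}v(x)` for `x ∈ Ω` with
`η < dist(x, ∂Ω)`, where `D^{σ,p}v` is the Gagliardo fractional derivative. -/
theorem mollifier_estimate_first_order
    (m ν : ℕ) (hm : 1 ≤ m) (σ p : ℝ) (hσ0 : 0 < σ) (hσ1 : σ < 1) (hp : 1 ≤ p)
    (φ : EuclideanSpace ℝ (Fin m) → ℝ) (hφs : ContDiff ℝ (⊤ : ℕ∞) φ)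
    (hφsupp : Function.support φ ⊆ Metric.ball 0 1) (hφnn : ∀ x, 0 ≤ φ x)
    (hφint : (∫ x, φ x) = 1) :
    ∃ C > 0, ∀ Ω : Set (EuclideanSpace ℝ (Fin m)), IsOpen Ω →
      ∀ v : EuclideanSpace ℝ (Fin m) → EuclideanSpace ℝ (Fin ν),
        AEStronglyMeasurable v volume →
        ∀ η : ℝ, 0 < η → ∀ x ∈ Ω, η < Metric.infDist x (frontier Ω) →
          ENNReal.ofReal
              ‖fderiv ℝ (fun z => ∫ y, (η ^ (-(m : ℝ)) * φ (η⁻¹ • (z - y))) • v y) x‖ ≤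
            ENNReal.ofReal (C * η ^ (σ - 1)) *
              (∫⁻ y in Ω,
                (‖v x - v y‖₊ : ℝ≥0∞) ^ p / (‖x - y‖₊ : ℝ≥0∞) ^ ((m : ℝ) + σ * p)) ^ (1 / p) := by
  have hp0 : 0 < p := by linarith
  have h1p : 0 ≤ 1 - 1 / p := by
    rw [sub_nonneg, div_le_one hp0]; exact hp
  have hφc : HasCompactSupport φ :=
    HasCompactSupport.of_support_subset_isCompact (isCompact_closedBall 0 1)
      (hφsupp.trans Metric.ball_subset_closedBall)
  obtain ⟨L, hL⟩ := (hφs.of_le (by simp) : ContDiff ℝ 1 φ).lipschitzWith_of_hasCompactSupport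
    hφc one_ne_zero
  set κ := volume (Metric.ball (0 : EuclideanSpace ℝ (Fin m)) 1) ^ (1 - 1 / p)
  have hκt : κ ≠ ⊤ := ENNReal.rpow_ne_top_of_nonneg h1p measure_ball_lt_top.ne
  refine ⟨L * κ.toReal * 2 ^ ((m : ℝ) + σ) + 1, by positivity, ?_⟩
  intro Ω hΩ v hv η hη x hx hηd
  change _ ≤ _ * (∫⁻ y in Ω, ‖v x - v y‖ₑ ^ p / ‖x - y‖ₑ ^ ((m : ℝ) + σ * p)) ^ (1 / p)
  set D := (∫⁻ y in Ω, ‖v x - v y‖ₑ ^ p / ‖x - y‖ₑ ^ ((m : ℝ) + σ * p)) ^ (1 / p)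
  rcases eq_or_ne D ⊤ with hDt | hDt
  · rw [hDt, ENNReal.mul_top (by rw [ne_eq, ENNReal.ofReal_eq_zero, not_le]; positivity)]
    exact le_top
  set R := min (Metric.infDist x (frontier Ω)) (2 * η)
  have hηR : η < R := lt_min hηd (by linarith)
  have hR : 0 < R := hη.trans hηR
  have hosc : ∫⁻ y in Metric.ball x R, ‖v y - v x‖ₑ ≤
      κ * ENNReal.ofReal (2 * η) ^ ((m : ℝ) + σ) * D := by
    refine (lintegral_ball_enorm_sub_le hσ0 hp hv hR
      (ball_subset_of_le_infDist_frontier hΩ hx hR (min_le_left _ _))).trans ?_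
    have : R ≤ 2 * η := min_le_right _ _
    gcongr
  have hint : IntegrableOn (fun y => v y - v x) (Metric.ball x R) :=
    ⟨(hv.sub aestronglyMeasurable_const).restrict, hosc.trans_lt (by finiteness)⟩
  have hηm : 0 < η ^ (-(m : ℝ)) := by positivity
  have hg : LipschitzWith (η ^ (-(m : ℝ)) * (L * η⁻¹)).toNNReal
      (fun y => η ^ (-(m : ℝ)) * φ (η⁻¹ • y)) := by
    refine LipschitzWith.of_dist_le_mul fun y z => ?_
    rw [Real.coe_toNNReal _ (by positivity), Real.dist_eq, ← mul_sub, abs_mul, abs_of_pos hηm,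
      mul_assoc]
    gcongr
    have := hL.dist_le_mul (η⁻¹ • y) (η⁻¹ • z)
    rwa [Real.dist_eq, dist_smul₀, Real.norm_of_nonneg (by positivity), ← mul_assoc] at this
  have hsupp : Function.support (fun y => η ^ (-(m : ℝ)) * φ (η⁻¹ • y)) ⊆ Metric.ball 0 η := by
    intro y hy
    have h1 := hφsupp (right_ne_zero_of_mul hy)
    rwa [mem_ball_zero_iff, norm_smul, Real.norm_of_nonneg (by positivity),
      inv_mul_lt_one₀ hη, ← mem_ball_zero_iff] at h1
  have hmain := norm_fderiv_integral_smul_le volume hg hηR hsupp hint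
  rw [Real.coe_toNNReal _ (by positivity)] at hmain
  calc _ ≤ ENNReal.ofReal (η ^ (-(m : ℝ)) * (L * η⁻¹)) *
        ∫⁻ y in Metric.ball x R, ‖v y - v x‖ₑ := by
        rw [← ofReal_integral_norm_eq_lintegral_enorm hint, ← ENNReal.ofReal_mul (by positivity)]
        exact ENNReal.ofReal_le_ofReal hmain
    _ ≤ ENNReal.ofReal (η ^ (-(m : ℝ)) * (L * η⁻¹)) *
        (κ * ENNReal.ofReal (2 * η) ^ ((m : ℝ) + σ) * D) := by gcongr
    _ = ENNReal.ofReal (L * κ.toReal * 2 ^ ((m : ℝ) + σ) * η ^ (σ - 1)) * D := by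
        rw [← ENNReal.ofReal_toReal hκt, ENNReal.ofReal_rpow_of_pos (by positivity), ← mul_assoc,
          ← ENNReal.ofReal_mul (by positivity), ← ENNReal.ofReal_mul (by positivity),
          ENNReal.toReal_ofReal (by positivity), Real.mul_rpow zero_le_two hη.le]
        congr 2
        have : η ^ (σ - 1) = η ^ (-(m : ℝ)) * η⁻¹ * η ^ ((m : ℝ) + σ) := by
          rw [← Real.rpow_neg_one η, ← Real.rpow_add hη, ← Real.rpow_add hη]
          congr 1
          ring
        rw [this]
        ring
    _ ≤ _ := by
        gcongr
        linarith
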